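/- Let n ≥ 1, m ∈ ℕ with m ≥ 1, and let p₀, q₀, p₁, …, p_m, q₁, …, q_m ∈ [1, ∞] satisfy ∑_{i=1}^m 1/p_i = 1/p₀ and ∑_{i=1}^m 1/q_i = m − 1 + 1/q₀ (with 1/∞ = 0). Then there exists a constant C > 0 such that for all Schwartz functions f₁, …, f_m ∈ 𝒮(ℝⁿ): ‖∏_{i=1}^m f_i‖_{M^{p₀,q₀}} ≤ C ∏_{i=1}^m ‖f_i‖_{M^{p_i,q_i}}. -/

import Mathlib

open scoped RealInnerProductSpace ENNReal BigOperators
open MeasureTheory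

noncomputable section

/-- Short-time Fourier transform on `ℝⁿ` with Gaussian window `φ(y) = e^{-|y|²}`. -/
def STFT (n : ℕ) (f : EuclideanSpace ℝ (Fin n) → ℂ) (x ξ : EuclideanSpace ℝ (Fin n)) : ℂ :=
  ∫ y : EuclideanSpace ℝ (Fin n),
    f y * Complex.exp (-((‖y - x‖ ^ 2 : ℝ) : ℂ)) * Complex.exp (-Complex.I * (⟪y, ξ⟫ : ℝ))

/-- The `L^p` "norm" of an `ℝ≥0∞`-valued function, `essSup` when `p = ∞`. -/
def eLp {α : Type*} [MeasurableSpace α] (p : ℝ≥0∞) (μ : Measure α) (f : α → ℝ≥0∞) : ℝ≥0∞ :=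
  if p = ∞ then essSup f μ else (∫⁻ a, f a ^ p.toReal ∂μ) ^ (1 / p.toReal)

/-- The (unweighted) modulation norm `‖f‖_{M^{p,q}}` with Gaussian window. -/
def modNorm (n : ℕ) (p q : ℝ≥0∞) (f : EuclideanSpace ℝ (Fin n) → ℂ) : ℝ≥0∞ :=
  eLp q volume (fun ξ => eLp p volume (fun x => ENNReal.ofReal ‖STFT n f x ξ‖))

section LpNorm

variable {α β : Type*} [MeasurableSpace α] [MeasurableSpace β] {μ : Measure α} {ν : Measure β}

lemma eLp_top (f : α → ℝ≥0∞) : eLp ∞ μ f = essSup f μ := if_pos rfl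

lemma eLp_of_ne_top {p : ℝ≥0∞} (hp : p ≠ ∞) (f : α → ℝ≥0∞) :
    eLp p μ f = (∫⁻ a, f a ^ p.toReal ∂μ) ^ (1 / p.toReal) := if_neg hp

lemma toReal_pos_of_one_le {p : ℝ≥0∞} (h1 : 1 ≤ p) (hp : p ≠ ∞) : 0 < p.toReal :=
  ENNReal.toReal_pos (zero_lt_one.trans_le h1).ne' hp

lemma eLp_mono {p : ℝ≥0∞} {f g : α → ℝ≥0∞} (h : ∀ a, f a ≤ g a) : eLp p μ f ≤ eLp p μ g := by
  by_cases hp : p = ∞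
  · subst hp
    rw [eLp_top, eLp_top]
    exact essSup_mono_ae (ae_of_all _ h)
  · rw [eLp_of_ne_top hp, eLp_of_ne_top hp]
    gcongr with a
    exact h a

lemma eLp_one (f : α → ℝ≥0∞) : eLp 1 μ f = ∫⁻ a, f a ∂μ := by
  simp [eLp_of_ne_top]

lemma eLp_const_mul {p : ℝ≥0∞} (hp : 1 ≤ p) {c : ℝ≥0∞} {f : α → ℝ≥0∞} (hf : Measurable f) :
    eLp p μ (fun a ↦ c * f a) = c * eLp p μ f := by
  by_cases hp' : p = ∞
  · subst hp'
    rw [eLp_top, eLp_top, ENNReal.essSup_const_mul]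
  · have h0 := toReal_pos_of_one_le hp hp'
    rw [eLp_of_ne_top hp', eLp_of_ne_top hp']
    simp_rw [ENNReal.mul_rpow_of_nonneg _ _ h0.le]
    rw [lintegral_const_mul _ (hf.pow_const _), ENNReal.mul_rpow_of_nonneg _ _ (by positivity),
      ← ENNReal.rpow_mul, mul_one_div_cancel h0.ne', ENNReal.rpow_one]

lemma eLp_comp_measurePreserving (p : ℝ≥0∞) {e : α ≃ᵐ α} (he : MeasurePreserving e μ μ)
    {f : α → ℝ≥0∞} (hf : Measurable f) :
    eLp p μ (fun a ↦ f (e a)) = eLp p μ f := by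
  by_cases hp : p = ∞
  · subst hp
    rw [eLp_top, eLp_top]
    conv_rhs => rw [← he.map_eq]
    exact (essSup_map_measure_of_measurable hf he.measurable.aemeasurable).symm
  · rw [eLp_of_ne_top hp, eLp_of_ne_top hp]
    congr 1
    exact he.lintegral_comp (hf.pow_const _)

lemma measurable_eLp_left [SFinite μ] (p : ℝ≥0∞) {F : α → β → ℝ≥0∞}
    (hF : Measurable (Function.uncurry F)) : Measurable fun y ↦ eLp p μ (fun x ↦ F x y) := by
  by_cases hp : p = ∞
  · subst hp
    simp_rw [eLp_top]
    refine measurable_of_Iic fun c ↦ ?_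
    have hset : (fun y ↦ essSup (fun x ↦ F x y) μ) ⁻¹' Set.Iic c =
        (fun y ↦ μ ((fun x ↦ (x, y)) ⁻¹' (Function.uncurry F ⁻¹' Set.Ioi c))) ⁻¹' {0} := by
      ext y
      simp only [Set.mem_preimage, Set.mem_Iic, Set.mem_singleton_iff]
      have : essSup (fun x ↦ F x y) μ ≤ c ↔ ∀ᵐ x ∂μ, F x y ≤ c :=
        ⟨fun h ↦ (ENNReal.ae_le_essSup _).mono fun x hx ↦ hx.trans h,
          fun h ↦ essSup_le_of_ae_le _ h⟩
      rw [this, ae_iff]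
      simp only [not_le]
      rfl
    rw [hset]
    exact measurable_measure_prodMk_right (hF measurableSet_Ioi) (measurableSet_singleton 0)
  · simp_rw [eLp_of_ne_top hp]
    exact ((hF.pow_const _).lintegral_prod_left').pow_const _

lemma toReal_inv_add {p q r : ℝ≥0∞} (hp : p ≠ 0) (hq : q ≠ 0) (h : 1 / p + 1 / q = 1 / r) :
    1 / p.toReal + 1 / q.toReal = 1 / r.toReal := by
  have := congrArg ENNReal.toReal h
  rw [ENNReal.toReal_add (by simp [hp]) (by simp [hq])] at this
  simpa using this

/-- Hölder's inequality for `eLp`. -/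
lemma eLp_mul_le {p q r : ℝ≥0∞} (hp : 1 ≤ p) (hq : 1 ≤ q) (hr : 1 ≤ r)
    (h : 1 / p + 1 / q = 1 / r) {f g : α → ℝ≥0∞} (hf : Measurable f) (hg : Measurable g) :
    eLp r μ (fun a ↦ f a * g a) ≤ eLp p μ f * eLp q μ g := by
  have key : ∀ {q : ℝ≥0∞} {f g : α → ℝ≥0∞}, 1 ≤ q → Measurable g →
      eLp q μ (fun a ↦ f a * g a) ≤ eLp ∞ μ f * eLp q μ g := by
    intro q f g hq hg
    rw [← eLp_const_mul hq hg]
    have hfe := ENNReal.ae_le_essSup (μ := μ) f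
    by_cases hq' : q = ∞
    · subst hq'
      simp only [eLp_top]
      exact essSup_mono_ae (hfe.mono fun a ha ↦ mul_le_mul_left ha _)
    · rw [eLp_of_ne_top hq', eLp_of_ne_top hq', eLp_top]
      refine ENNReal.rpow_le_rpow (lintegral_mono_ae (hfe.mono fun a ha ↦ ?_)) (by positivity)
      gcongr
  by_cases hp' : p = ∞
  · subst hp'
    obtain rfl : q = r := by simpa using h
    exact key hq hg
  by_cases hq' : q = ∞
  · subst hq'
    obtain rfl : p = r := by simpa using h
    rw [mul_comm (eLp p μ f)]
    simp_rw [mul_comm (f _)]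
    exact key hp hf
  have hr' : r ≠ ∞ := by
    rintro rfl
    simp [hp'] at h
  have hreal := toReal_inv_add (zero_lt_one.trans_le hp).ne' (zero_lt_one.trans_le hq).ne' h
  have h1 := toReal_pos_of_one_le hp hp'
  have h2 := toReal_pos_of_one_le hq hq'
  have h3 := toReal_pos_of_one_le hr hr'
  rw [eLp_of_ne_top hp', eLp_of_ne_top hq', eLp_of_ne_top hr']
  refine ENNReal.lintegral_Lp_mul_le_Lq_mul_Lr h3 ?_ hreal.symm μ hf.aemeasurable hg.aemeasurable
  have : 0 < 1 / q.toReal := by positivity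
  exact lt_of_one_div_lt_one_div h1 (by linarith)

/-- Minkowski's integral inequality for `eLp`. -/
lemma eLp_lintegral_le [SigmaFinite μ] [SFinite ν] {p : ℝ≥0∞} (hp : 1 ≤ p) {F : α → β → ℝ≥0∞}
    (hF : Measurable (Function.uncurry F)) :
    eLp p μ (fun x ↦ ∫⁻ y, F x y ∂ν) ≤ ∫⁻ y, eLp p μ (fun x ↦ F x y) ∂ν := by
  by_cases hp' : p = ∞
  · subst hp'
    have hm := measurable_eLp_left (μ := μ) ∞ hF
    rw [eLp_top]
    refine essSup_le_of_ae_le _ ?_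
    have h : ∀ᵐ y ∂ν, ∀ᵐ x ∂μ, F x y ≤ eLp ∞ μ (fun x ↦ F x y) :=
      ae_of_all _ fun y ↦ by rw [eLp_top]; exact ENNReal.ae_le_essSup _
    have hs : MeasurableSet {z : α × β | F z.1 z.2 ≤ eLp ∞ μ (fun x ↦ F x z.2)} :=
      measurableSet_le hF (hm.comp measurable_snd)
    have h' : ∀ᵐ x ∂μ, ∀ᵐ y ∂ν, F x y ≤ eLp ∞ μ (fun x ↦ F x y) :=
      (Measure.ae_ae_comm hs).2 h
    exact h'.mono fun x hx ↦ lintegral_mono_ae hx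
  have h0 := toReal_pos_of_one_le hp hp'
  have h1 : 1 ≤ p.toReal := by simpa using ENNReal.toReal_mono hp' hp
  set P := p.toReal
  set R := ∫⁻ y, eLp p μ (fun x ↦ F x y) ∂ν
  rw [eLp_of_ne_top hp', one_div, ENNReal.rpow_inv_le_iff h0]
  by_contra! hlt
  rw [lintegral_eq_nnreal] at hlt
  simp_rw [lt_iSup_iff] at hlt
  obtain ⟨φ, hφ, hφR⟩ := hlt
  rw [← SimpleFunc.lintegral_eq_lintegral] at hφR
  simp only [SimpleFunc.map_apply] at hφR
  obtain ⟨g, hgφ, hgfin, hRg⟩ := SimpleFunc.exists_lt_lintegral_simpleFunc_of_lt_lintegral hφR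
  set X := ∫⁻ x, (g x : ℝ≥0∞) ∂μ
  have hgm : Measurable fun x ↦ (g x : ℝ≥0∞) := g.measurable.coe_nnreal_ennreal
  have hle : X ≤ X ^ (1 - 1 / P) * R := by
    calc X ≤ ∫⁻ x, (g x : ℝ≥0∞) ^ (1 - 1 / P) * ∫⁻ y, F x y ∂ν ∂μ := by
          refine lintegral_mono fun x ↦ ?_
          have hx : (g x : ℝ≥0∞) ≤ (∫⁻ y, F x y ∂ν) ^ P :=
            le_trans (by exact_mod_cast hgφ x) (hφ x)
          calc (g x : ℝ≥0∞) = (g x : ℝ≥0∞) ^ (1 - 1 / P) * (g x : ℝ≥0∞) ^ (1 / P) := by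
                rw [← ENNReal.rpow_add_of_nonneg _ _ _ (by positivity)]
                · simp
                · rw [sub_nonneg, div_le_one h0]
                  exact h1
            _ ≤ _ := by
                gcongr
                rw [one_div, ENNReal.rpow_inv_le_iff h0]
                exact hx
      _ = ∫⁻ x, ∫⁻ y, (g x : ℝ≥0∞) ^ (1 - 1 / P) * F x y ∂ν ∂μ := by
          refine lintegral_congr fun x ↦ ?_
          exact (lintegral_const_mul _ (hF.comp measurable_prodMk_left)).symm
      _ = ∫⁻ y, ∫⁻ x, (g x : ℝ≥0∞) ^ (1 - 1 / P) * F x y ∂μ ∂ν := by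
          refine lintegral_lintegral_swap (Measurable.aemeasurable ?_)
          exact ((hgm.comp measurable_fst).pow_const _).mul hF
      _ ≤ ∫⁻ y, X ^ (1 - 1 / P) * eLp p μ (fun x ↦ F x y) ∂ν := by
          refine lintegral_mono fun y ↦ ?_
          have hFy : Measurable fun x ↦ F x y := hF.comp measurable_prodMk_right
          have := ENNReal.lintegral_mul_norm_pow_le (μ := μ) (p := 1 - 1 / P) (q := 1 / P)
            hgm.aemeasurable (hFy.pow_const P).aemeasurable
            (by rw [sub_nonneg, div_le_one h0]; exact h1) (by positivity) (by ring)
          rw [eLp_of_ne_top hp']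
          simpa only [← ENNReal.rpow_mul, mul_one_div_cancel h0.ne', ENNReal.rpow_one] using this
      _ = X ^ (1 - 1 / P) * R := lintegral_const_mul _ (measurable_eLp_left p hF)
  have hX0 : X ≠ 0 := (bot_le.trans_lt hRg).ne'
  have hfin : X ^ (1 - 1 / P) ≠ ∞ :=
    ENNReal.rpow_ne_top_of_nonneg (by rw [sub_nonneg, div_le_one h0]; exact h1) hgfin.ne
  have hne : X ^ (1 - 1 / P) ≠ 0 := by simp [ENNReal.rpow_eq_zero_iff, hX0, hgfin.ne]
  have hsplit : X = X ^ (1 - 1 / P) * X ^ (1 / P) := by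
    rw [← ENNReal.rpow_add _ _ hX0 hgfin.ne]
    simp
  have hXR : X ^ (1 / P) ≤ R :=
    (ENNReal.mul_le_mul_iff_right hne hfin).1 (hsplit.symm.le.trans hle)
  rw [one_div, ENNReal.rpow_inv_le_iff h0] at hXR
  exact absurd hRg (not_lt.2 hXR)

end LpNorm

section Young

variable {G : Type*} [AddCommGroup G] [MeasurableSpace G] [MeasurableAdd₂ G] [MeasurableNeg G]
  {μ : Measure G} [SFinite μ] [μ.IsAddLeftInvariant] [μ.IsNegInvariant]

/-- Young's convolution inequality for `eLp`. -/
lemma eLp_convolution_le {p q r : ℝ≥0∞} (hp : 1 ≤ p) (hq : 1 ≤ q) (hr : 1 ≤ r)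
    (h : 1 / p + 1 / q = 1 + 1 / r) {f g : G → ℝ≥0∞} (hf : Measurable f) (hg : Measurable g) :
    eLp r μ (fun x ↦ ∫⁻ y, f y * g (x - y) ∂μ) ≤ eLp p μ f * eLp q μ g := by
  have hgx : ∀ x, Measurable fun y ↦ g (x - y) := fun x ↦
    hg.comp (measurable_const.sub measurable_id)
  by_cases hr' : r = ∞
  · subst hr'
    rw [eLp_top]
    refine essSup_le_of_ae_le _ (ae_of_all _ fun x ↦ ?_)
    have hH := eLp_mul_le (μ := μ) hp hq le_rfl (by simpa using h) hf (hgx x)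
    rw [eLp_one] at hH
    have he : eLp q μ (fun y ↦ g (x - y)) = eLp q μ g :=
      eLp_comp_measurePreserving q (e := MeasurableEquiv.subLeft x)
        (Measure.measurePreserving_sub_left μ x) hg
    rwa [he] at hH
  have hinv : ∀ {s : ℝ≥0∞}, 1 ≤ s → 1 / s ≤ 1 := fun hs ↦ by simpa using hs
  have hr0 : 1 / r ≠ 0 := by simpa using hr'
  have hlt : (1 : ℝ≥0∞) < 1 + 1 / r := ENNReal.lt_add_right ENNReal.one_ne_top hr0
  have hp' : p ≠ ∞ := by
    rintro rfl
    have : 1 / q = 1 + 1 / r := by simpa using h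
    exact absurd (hinv hq) (not_le.2 (this ▸ hlt))
  have hq' : q ≠ ∞ := by
    rintro rfl
    have : 1 / p = 1 + 1 / r := by simpa using h
    exact absurd (hinv hp) (not_le.2 (this ▸ hlt))
  have hreal : 1 / p.toReal + 1 / q.toReal = 1 + 1 / r.toReal := by
    have := congrArg ENNReal.toReal h
    rw [ENNReal.toReal_add (by simpa using (zero_lt_one.trans_le hp).ne')
      (by simpa using (zero_lt_one.trans_le hq).ne'),
      ENNReal.toReal_add (by simp) (by simpa using (zero_lt_one.trans_le hr).ne')] at this
    simpa using this
  have hP := toReal_pos_of_one_le hp hp'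
  have hQ := toReal_pos_of_one_le hq hq'
  have hR := toReal_pos_of_one_le hr hr'
  have hP1 : 1 / p.toReal ≤ 1 := by
    rw [div_le_one hP]; simpa using ENNReal.toReal_mono hp' hp
  have hQ1 : 1 / q.toReal ≤ 1 := by
    rw [div_le_one hQ]; simpa using ENNReal.toReal_mono hq' hq
  rw [eLp_of_ne_top hp', eLp_of_ne_top hq', eLp_of_ne_top hr']
  set P := p.toReal
  set Q := q.toReal
  set R := r.toReal
  set A := ∫⁻ y, f y ^ P ∂μ
  set B := ∫⁻ y, g y ^ Q ∂μ
  have ha : 0 ≤ 1 / P - 1 / R := by linarith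
  have hb : 0 ≤ 1 / Q - 1 / R := by linarith
  have hpt : ∀ x, ∫⁻ y, f y * g (x - y) ∂μ ≤
      (∫⁻ y, f y ^ P * g (x - y) ^ Q ∂μ) ^ (1 / R) * A ^ (1 / P - 1 / R) *
        B ^ (1 / Q - 1 / R) := by
    intro x
    have hB : ∫⁻ y, g (x - y) ^ Q ∂μ = B :=
      lintegral_sub_left_eq_self (fun y ↦ g y ^ Q) x
    have key := ENNReal.lintegral_prod_norm_pow_le (μ := μ) (Finset.univ : Finset (Fin 3))
      (f := ![fun y ↦ f y ^ P * g (x - y) ^ Q, fun y ↦ f y ^ P, fun y ↦ g (x - y) ^ Q])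
      (p := ![1 / R, 1 / P - 1 / R, 1 / Q - 1 / R])
      (by
        intro i _
        fin_cases i
        · exact ((hf.pow_const P).mul ((hgx x).pow_const Q)).aemeasurable
        · exact (hf.pow_const P).aemeasurable
        · exact ((hgx x).pow_const Q).aemeasurable)
      (by simp only [Fin.sum_univ_three, Matrix.cons_val]; linarith)
      (by
        intro i _
        fin_cases i
        · simp [hR.le]
        · exact ha
        · exact hb)
    simp only [Fin.prod_univ_three, Matrix.cons_val, hB] at key
    refine le_trans (lintegral_mono fun y ↦ le_of_eq ?_) key
    rw [ENNReal.mul_rpow_of_nonneg _ _ (by positivity)]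
    have hs : ∀ (t : ℝ≥0∞) {S : ℝ}, 0 < S → 0 ≤ 1 / S - 1 / R →
        t = (t ^ S) ^ (1 / R) * (t ^ S) ^ (1 / S - 1 / R) := by
      intro t S hS hSR
      rw [← ENNReal.rpow_add_of_nonneg _ _ (by positivity) hSR, ← ENNReal.rpow_mul]
      simp [hS.ne']
    conv_lhs => rw [hs (f y) hP ha, hs (g (x - y)) hQ hb]
    ring
  have hfg : Measurable fun z : G × G ↦ f z.2 ^ P * g (z.1 - z.2) ^ Q :=
    ((hf.comp measurable_snd).pow_const P).mul ((hg.comp measurable_sub).pow_const Q)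
  have htot : ∫⁻ x, ∫⁻ y, f y ^ P * g (x - y) ^ Q ∂μ ∂μ = A * B := by
    rw [lintegral_lintegral_swap hfg.aemeasurable]
    calc _ = ∫⁻ y, f y ^ P * B ∂μ := by
          refine lintegral_congr fun y ↦ ?_
          have hy : Measurable fun x ↦ g (x - y) := hg.comp (measurable_id.sub measurable_const)
          rw [lintegral_const_mul _ (hy.pow_const Q)]
          congr 1
          exact lintegral_sub_right_eq_self (fun y ↦ g y ^ Q) y
      _ = A * B := lintegral_mul_const _ (hf.pow_const P)
  rw [one_div R, ENNReal.rpow_inv_le_iff hR]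
  calc ∫⁻ x, (∫⁻ y, f y * g (x - y) ∂μ) ^ R ∂μ
      ≤ ∫⁻ x, (∫⁻ y, f y ^ P * g (x - y) ^ Q ∂μ) *
          (A ^ (1 / P - 1 / R) * B ^ (1 / Q - 1 / R)) ^ R ∂μ := by
        refine lintegral_mono fun x ↦ ?_
        refine (ENNReal.rpow_le_rpow (hpt x) hR.le).trans_eq ?_
        rw [mul_assoc, ENNReal.mul_rpow_of_nonneg _ _ hR.le, ← ENNReal.rpow_mul,
          one_div_mul_cancel hR.ne', ENNReal.rpow_one]
    _ = A * B * (A ^ (1 / P - 1 / R) * B ^ (1 / Q - 1 / R)) ^ R := by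
        rw [lintegral_mul_const _ hfg.lintegral_prod_right', htot]
    _ = (A ^ (1 / P) * B ^ (1 / Q)) ^ R := by
        have hs : ∀ (t : ℝ≥0∞) {S : ℝ}, 0 ≤ 1 / S - 1 / R →
            t ^ (1 / S) = t ^ (1 / R) * t ^ (1 / S - 1 / R) := by
          intro t S hSR
          rw [← ENNReal.rpow_add_of_nonneg _ _ (by positivity) hSR]
          congr 1
          ring
        have hAB : A * B = (A ^ (1 / R) * B ^ (1 / R)) ^ R := by
          rw [← ENNReal.mul_rpow_of_nonneg _ _ (by positivity : 0 ≤ 1 / R), ← ENNReal.rpow_mul,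
            one_div_mul_cancel hR.ne', ENNReal.rpow_one]
        rw [hAB, ← ENNReal.mul_rpow_of_nonneg _ _ hR.le, hs A ha, hs B hb]
        congr 1
        ring

end Young

section Gabor

open scoped FourierTransform SchwartzMap

lemma norm_cexp_neg_I_mul (t : ℝ) : ‖Complex.exp (-Complex.I * (t : ℂ))‖ = 1 := by
  rw [show -Complex.I * (t : ℂ) = ((-t : ℝ) : ℂ) * Complex.I by push_cast; ring]
  exact Complex.norm_exp_ofReal_mul_I _

lemma norm_gaussian_le_one {E : Type*} [NormedAddCommGroup E] {a : ℝ} (ha : 0 ≤ a) (x : E) :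
    ‖(Real.exp (-a * ‖x‖ ^ 2) : ℂ)‖ ≤ 1 := by
  rw [Complex.norm_real, Real.norm_eq_abs, Real.abs_exp, Real.exp_le_one_iff]
  nlinarith [mul_nonneg ha (sq_nonneg ‖x‖)]

lemma hasTemperateGrowth_gaussian {E : Type*} [NormedAddCommGroup E] [InnerProductSpace ℝ E]
    {a : ℝ} (ha : 0 ≤ a) (x : E) :
    (fun y : E ↦ Real.exp (-a * ‖y - x‖ ^ 2)).HasTemperateGrowth := by
  have hsq : (fun y : E ↦ a * ‖y - x‖ ^ 2).HasTemperateGrowth :=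
    (Function.HasTemperateGrowth.const a).mul
      ((Function.hasTemperateGrowth_norm_sq E).comp
        (Function.HasTemperateGrowth.id'.sub (.const x)))
  have hopen : IsOpen (Set.Ioi (-1 : ℝ)) := isOpen_Ioi
  have := Function.HasTemperateGrowth.comp' (g := fun t : ℝ ↦ Real.exp (-t))
    (t := Set.Ioi (-1 : ℝ)) (f := fun y : E ↦ a * ‖y - x‖ ^ 2)
    (by
      rintro _ ⟨y, rfl⟩
      exact lt_of_lt_of_le (by norm_num) (mul_nonneg ha (sq_nonneg ‖y - x‖)))
    hopen.uniqueDiffOn (by fun_prop)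
    (fun N ↦ ⟨0, Real.exp 1, (Real.exp_pos 1).le, fun n _ t ht ↦ by
      rw [norm_iteratedFDerivWithin_eq_norm_iteratedDerivWithin,
        iteratedDerivWithin_of_isOpen hopen ht, iteratedDeriv_comp_neg n Real.exp,
        iteratedDeriv_eq_iterate, Real.iter_deriv_exp]
      have : -t ≤ 1 := by have := Set.mem_Ioi.1 ht; linarith
      simpa [norm_smul] using this⟩) hsq
  convert this using 2 with y
  simp

/-- A Schwartz function multiplied by a translated Gaussian is a Schwartz function. -/
lemma exists_schwartz_mul_gaussian {E : Type*} [NormedAddCommGroup E] [InnerProductSpace ℝ E]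
    {a : ℝ} (ha : 0 ≤ a) (f : 𝓢(E, ℂ)) (x : E) :
    ∃ u : 𝓢(E, ℂ), ∀ y, u y = f y * (Real.exp (-a * ‖y - x‖ ^ 2) : ℂ) := by
  refine ⟨SchwartzMap.smulLeftCLM ℂ (fun y : E ↦ Real.exp (-a * ‖y - x‖ ^ 2)) f, fun y ↦ ?_⟩
  rw [SchwartzMap.smulLeftCLM_apply_apply (hasTemperateGrowth_gaussian ha x),
    Complex.real_smul, mul_comm]

variable {E : Type*} [NormedAddCommGroup E] [InnerProductSpace ℝ E] [FiniteDimensional ℝ E]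
  [MeasurableSpace E] [BorelSpace E]

/-- The short-time Fourier transform with window `y ↦ e^{-a|y|²}`. -/
def gabor (a : ℝ) (f : E → ℂ) (x ξ : E) : ℂ :=
  ∫ y : E, f y * (Real.exp (-a * ‖y - x‖ ^ 2) : ℂ) * Complex.exp (-Complex.I * (⟪y, ξ⟫ : ℝ))

lemma continuous_gabor {a : ℝ} (ha : 0 ≤ a) {f : E → ℂ} (hf : Integrable f) :
    Continuous (Function.uncurry (gabor a f)) := by
  refine continuous_of_dominated (bound := fun y ↦ ‖f y‖) (fun z ↦ ?_) (fun z ↦ ?_) hf.norm ?_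
  · exact (hf.1.mul (Continuous.aestronglyMeasurable (by fun_prop))).mul
      (Continuous.aestronglyMeasurable (by fun_prop))
  · refine ae_of_all _ fun y ↦ ?_
    rw [norm_mul, norm_mul, norm_cexp_neg_I_mul, mul_one]
    exact mul_le_of_le_one_right (norm_nonneg _) (norm_gaussian_le_one ha _)
  · exact ae_of_all _ fun y ↦ by fun_prop

lemma measurable_enorm_gabor {a : ℝ} (ha : 0 ≤ a) {f : E → ℂ} (hf : Integrable f) :
    Measurable (Function.uncurry fun x ξ ↦ ‖gabor a f x ξ‖ₑ) :=
  (continuous_gabor ha hf).measurable.enorm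

lemma gabor_eq_fourier (a : ℝ) (f : E → ℂ) (x ξ : E) :
    gabor a f x ξ =
      𝓕 (fun y ↦ f y * (Real.exp (-a * ‖y - x‖ ^ 2) : ℂ)) ((2 * Real.pi)⁻¹ • ξ) := by
  rw [Real.fourier_eq']
  refine integral_congr_ae (ae_of_all _ fun y ↦ ?_)
  simp only [smul_eq_mul, inner_smul_right]
  rw [mul_comm]
  congr 2
  have : (Real.pi : ℂ) ≠ 0 := by exact_mod_cast Real.pi_ne_zero
  push_cast
  field_simp

/-- The Fourier transform of a product is the convolution of the Fourier transforms. -/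
lemma fourier_mul_eq_integral (u : 𝓢(E, ℂ)) {v : E → ℂ} (hv : Integrable v) (ζ : E) :
    𝓕 (fun y ↦ u y * v y) ζ = ∫ t, 𝓕 (u : E → ℂ) t * 𝓕 v (ζ - t) := by
  have hg : Integrable fun y ↦ Real.fourierChar (-⟪y, ζ⟫) • v y :=
    (Real.fourierIntegral_convergent_iff ζ).2 hv
  have hinv : 𝓕 ((𝓕⁻ u : 𝓢(E, ℂ)) : E → ℂ) = u := by
    rw [← SchwartzMap.fourier_coe, FourierTransform.fourier_fourierInv_eq]
  have hflip := VectorFourier.integral_fourierIntegral_smul_eq_flip (L := innerₗ E) (μ := volume)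
    (ν := volume) Real.continuous_fourierChar continuous_inner (𝓕⁻ u : 𝓢(E, ℂ)).integrable hg
  calc 𝓕 (fun y ↦ u y * v y) ζ = ∫ y, u y * (Real.fourierChar (-⟪y, ζ⟫) • v y) := by
        rw [Real.fourier_eq]
        refine integral_congr_ae (ae_of_all _ fun y ↦ ?_)
        simp only [Circle.smul_def, smul_eq_mul]
        ring
    _ = ∫ t, 𝓕 ((𝓕⁻ u : 𝓢(E, ℂ)) : E → ℂ) t * (Real.fourierChar (-⟪t, ζ⟫) • v t) := by rw [hinv]
    _ = ∫ t, (𝓕⁻ u : 𝓢(E, ℂ)) t * 𝓕 (fun y ↦ Real.fourierChar (-⟪y, ζ⟫) • v y) t := by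
        simpa using! hflip
    _ = ∫ t, 𝓕 (u : E → ℂ) (-t) * 𝓕 v (ζ - -t) := by
        refine integral_congr_ae (ae_of_all _ fun t ↦ ?_)
        simp only
        rw [SchwartzMap.fourierInv_coe, Real.fourierInv_eq_fourier_neg, Real.fourier_eq,
          Real.fourier_eq, Real.fourier_eq]
        congr 2
        ext y
        rw [smul_smul, ← AddChar.map_add_eq_mul]
        congr 2
        simp [inner_add_right]
    _ = _ := integral_neg_eq_self (fun t ↦ 𝓕 (u : E → ℂ) t * 𝓕 v (ζ - t)) volume

lemma enorm_gabor_mul_le {a b : ℝ} (ha : 0 ≤ a) (hb : 0 ≤ b) (f g : 𝓢(E, ℂ)) (x ξ : E) :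
    ‖gabor (a + b) (fun y ↦ f y * g y) x ξ‖ₑ ≤
      ∫⁻ η, ‖gabor a f x η‖ₑ * ‖gabor b g x (ξ - η)‖ₑ := by
  obtain ⟨u, hu⟩ := exists_schwartz_mul_gaussian ha f x
  obtain ⟨v, hv⟩ := exists_schwartz_mul_gaussian hb g x
  have hconv := fourier_mul_eq_integral u v.integrable ((2 * Real.pi)⁻¹ • ξ)
  have hL : gabor (a + b) (fun y ↦ f y * g y) x ξ =
      𝓕 (fun y ↦ u y * v y) ((2 * Real.pi)⁻¹ • ξ) := by
    rw [gabor_eq_fourier]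
    refine congrArg (fun w : E → ℂ ↦ 𝓕 w ((2 * Real.pi)⁻¹ • ξ)) (funext fun y ↦ ?_)
    rw [hu, hv, neg_add, add_mul, Real.exp_add]
    push_cast
    ring
  have hscale := Measure.integral_comp_smul volume
    (fun t ↦ 𝓕 (u : E → ℂ) t * 𝓕 (v : E → ℂ) ((2 * Real.pi)⁻¹ • ξ - t)) (2 * Real.pi)⁻¹
  rw [← hconv, ← hL] at hscale
  have hint : ∫ η, gabor a f x η * gabor b g x (ξ - η) =
      |(((2 * Real.pi)⁻¹) ^ Module.finrank ℝ E)⁻¹| •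
        gabor (a + b) (fun y ↦ f y * g y) x ξ := by
    rw [← hscale]
    refine integral_congr_ae (ae_of_all _ fun η ↦ ?_)
    simp only [gabor_eq_fourier, smul_sub, ← hu, ← hv]
  have hK : 1 ≤ |(((2 * Real.pi)⁻¹) ^ Module.finrank ℝ E)⁻¹| := by
    rw [inv_pow, inv_inv, abs_of_nonneg (by positivity)]
    exact one_le_pow₀ (by linarith [Real.pi_gt_three])
  calc ‖gabor (a + b) (fun y ↦ f y * g y) x ξ‖ₑ
      ≤ ‖∫ η, gabor a f x η * gabor b g x (ξ - η)‖ₑ := by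
        rw [hint, enorm_le_iff_norm_le, norm_smul, Real.norm_eq_abs, abs_abs]
        exact le_mul_of_one_le_left (norm_nonneg _) hK
    _ ≤ ∫⁻ η, ‖gabor a f x η * gabor b g x (ξ - η)‖ₑ := enorm_integral_le_lintegral_enorm _
    _ = _ := by simp_rw [enorm_mul]

end Gabor

section MixedNorm

variable {E : Type*} [NormedAddCommGroup E] [InnerProductSpace ℝ E] [FiniteDimensional ℝ E]
  [MeasurableSpace E] [BorelSpace E]

/-- The mixed norm `L^q_ξ(L^p_x)`. -/
def mixedNorm (p q : ℝ≥0∞) (F : E → E → ℝ≥0∞) : ℝ≥0∞ :=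
  eLp q volume fun ξ ↦ eLp p volume fun x ↦ F x ξ

lemma mixedNorm_mono {p q : ℝ≥0∞} {F G : E → E → ℝ≥0∞} (h : ∀ x ξ, F x ξ ≤ G x ξ) :
    mixedNorm p q F ≤ mixedNorm p q G :=
  eLp_mono fun ξ ↦ eLp_mono fun x ↦ h x ξ

/-- Hölder in the first variable combined with Young in the second one. -/
lemma mixedNorm_convolution_le {p q p₁ q₁ p₂ q₂ : ℝ≥0∞} (hp : 1 ≤ p) (hq : 1 ≤ q) (hp₁ : 1 ≤ p₁)
    (hq₁ : 1 ≤ q₁) (hp₂ : 1 ≤ p₂) (hq₂ : 1 ≤ q₂) (hpp : 1 / p₁ + 1 / p₂ = 1 / p)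
    (hqq : 1 / q₁ + 1 / q₂ = 1 + 1 / q) {F G : E → E → ℝ≥0∞}
    (hF : Measurable (Function.uncurry F)) (hG : Measurable (Function.uncurry G)) :
    mixedNorm p q (fun x ξ ↦ ∫⁻ η, F x η * G x (ξ - η)) ≤
      mixedNorm p₁ q₁ F * mixedNorm p₂ q₂ G := by
  refine le_trans (eLp_mono fun ξ ↦ ?_)
    (eLp_convolution_le hq₁ hq₂ hq hqq (measurable_eLp_left p₁ hF) (measurable_eLp_left p₂ hG))
  have hGξ : Measurable (Function.uncurry fun x η ↦ G x (ξ - η)) :=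
    hG.comp (measurable_fst.prodMk (measurable_const.sub measurable_snd))
  refine (eLp_lintegral_le hp (hF.mul hGξ)).trans (lintegral_mono fun η ↦ ?_)
  exact eLp_mul_le hp₁ hp₂ hp hpp hF.of_uncurry_right (hG.of_uncurry_right (y := ξ - η))

lemma mixedNorm_lintegral_translate_le {p q : ℝ≥0∞} (hp : 1 ≤ p) (hq : 1 ≤ q) {g : E → ℝ≥0∞}
    (hg : Measurable g) {F : E → E → ℝ≥0∞} (hF : Measurable (Function.uncurry F)) :
    mixedNorm p q (fun x ξ ↦ ∫⁻ w, g w * F (x + w) ξ) ≤ (∫⁻ w, g w) * mixedNorm p q F := by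
  rw [mixedNorm, mixedNorm, ← eLp_const_mul hq (measurable_eLp_left p hF)]
  refine eLp_mono fun ξ ↦ ?_
  have hFξ : Measurable fun x ↦ F x ξ := hF.of_uncurry_right
  have hgF : Measurable (Function.uncurry fun x w ↦ g w * F (x + w) ξ) :=
    (hg.comp measurable_snd).mul (hFξ.comp (measurable_fst.add measurable_snd))
  calc eLp p volume (fun x ↦ ∫⁻ w, g w * F (x + w) ξ)
      ≤ ∫⁻ w, eLp p volume (fun x ↦ g w * F (x + w) ξ) := eLp_lintegral_le hp hgF
    _ = ∫⁻ w, g w * eLp p volume (fun x ↦ F x ξ) := by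
        refine lintegral_congr fun w ↦ ?_
        have hw : Measurable fun x ↦ F (x + w) ξ := hFξ.comp (measurable_id.add_const w)
        rw [eLp_const_mul hp hw]
        have := eLp_comp_measurePreserving p (e := MeasurableEquiv.addRight w)
          (measurePreserving_add_right volume w) hFξ
        rw [← this, MeasurableEquiv.coe_addRight]
    _ = (∫⁻ w, g w) * eLp p volume (fun x ↦ F x ξ) := lintegral_mul_const _ hg

lemma integral_gaussian_pos {b : ℝ} (hb : 0 < b) : 0 < ∫ w : E, Real.exp (-b * ‖w‖ ^ 2) := by
  rw [GaussianFourier.integral_rexp_neg_mul_sq_norm hb]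
  positivity

lemma integrable_gaussian {b : ℝ} (hb : 0 < b) : Integrable fun w : E ↦ Real.exp (-b * ‖w‖ ^ 2) :=
  .of_integral_ne_zero (integral_gaussian_pos hb).ne'

/-- The convolution of two Gaussians is a Gaussian. -/
lemma integral_gaussian_mul_gaussian {b : ℝ} (hb : 0 < 1 + b) (u : E) :
    ∫ w : E, Real.exp (-b * ‖w‖ ^ 2) * Real.exp (-1 * ‖u - w‖ ^ 2) =
      (∫ w : E, Real.exp (-(1 + b) * ‖w‖ ^ 2)) * Real.exp (-(b / (1 + b)) * ‖u‖ ^ 2) := by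
  rw [← integral_mul_const,
    ← integral_sub_right_eq_self (fun w : E ↦ Real.exp (-(1 + b) * ‖w‖ ^ 2) * _)
      ((1 + b)⁻¹ • u)]
  refine integral_congr_ae (ae_of_all _ fun w ↦ ?_)
  simp only [← Real.exp_add]
  congr 1
  rw [norm_sub_sq_real, norm_sub_sq_real, norm_smul, inner_smul_right, mul_pow,
    Real.norm_eq_abs, sq_abs, real_inner_comm]
  field_simp
  ring

lemma integral_gaussian_mul_gabor {b : ℝ} (hb : 0 < b) {f : E → ℂ} (hf : Integrable f) (x ξ : E) :
    ∫ w : E, (Real.exp (-b * ‖w‖ ^ 2) : ℂ) * gabor 1 f (x + w) ξ =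
      ((∫ w : E, Real.exp (-(1 + b) * ‖w‖ ^ 2) : ℝ) : ℂ) * gabor (b / (1 + b)) f x ξ := by
  have hint : Integrable (Function.uncurry fun w y : E ↦ (Real.exp (-b * ‖w‖ ^ 2) : ℂ) *
      (f y * (Real.exp (-1 * ‖y - (x + w)‖ ^ 2) : ℂ) *
        Complex.exp (-Complex.I * (⟪y, ξ⟫ : ℝ)))) (volume.prod volume) := by
    refine ((integrable_gaussian hb).ofReal (𝕜 := ℂ) |>.mul_prod hf).mono ?_
      (ae_of_all _ fun z ↦ ?_)
    · exact (Continuous.aestronglyMeasurable (by fun_prop)).mul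
        ((hf.1.comp_snd.mul (Continuous.aestronglyMeasurable (by fun_prop))).mul
          (Continuous.aestronglyMeasurable (by fun_prop)))
    · simp only [Function.uncurry]
      rw [norm_mul, norm_mul, norm_mul, norm_mul, norm_cexp_neg_I_mul, mul_one]
      exact mul_le_mul_of_nonneg_left
        (mul_le_of_le_one_right (norm_nonneg _) (norm_gaussian_le_one zero_le_one _))
        (norm_nonneg _)
  simp only [gabor, ← integral_const_mul]
  rw [integral_integral_swap hint]
  refine integral_congr_ae (ae_of_all _ fun y ↦ ?_)
  have h := congrArg (fun t : ℝ ↦ (t : ℂ)) (integral_gaussian_mul_gaussian (b := b) (by positivity)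
    (y - x))
  simp only [Complex.ofReal_mul, ← integral_complex_ofReal] at h
  calc ∫ w : E, (Real.exp (-b * ‖w‖ ^ 2) : ℂ) * (f y * (Real.exp (-1 * ‖y - (x + w)‖ ^ 2) : ℂ) *
        Complex.exp (-Complex.I * (⟪y, ξ⟫ : ℝ)))
      = ∫ w : E, (f y * Complex.exp (-Complex.I * (⟪y, ξ⟫ : ℝ))) *
          ((Real.exp (-b * ‖w‖ ^ 2) : ℂ) * (Real.exp (-1 * ‖y - x - w‖ ^ 2) : ℂ)) := by
        refine integral_congr_ae (ae_of_all _ fun w ↦ ?_)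
        simp only [sub_add_eq_sub_sub]
        ring
    _ = _ := by
        rw [integral_const_mul, h, integral_complex_ofReal]
        ring

/-- Passing to a wider Gaussian window amounts to averaging over translations. -/
lemma exists_enorm_gabor_le {a : ℝ} (ha : 0 < a) (ha1 : a < 1) :
    ∃ g : E → ℝ≥0∞, Measurable g ∧ ∫⁻ w, g w ≠ ∞ ∧ ∀ f : E → ℂ, Integrable f → ∀ x ξ,
      ‖gabor a f x ξ‖ₑ ≤ ∫⁻ w, g w * ‖gabor 1 f (x + w) ξ‖ₑ := by
  obtain ⟨b, hb, hab⟩ : ∃ b : ℝ, 0 < b ∧ b / (1 + b) = a :=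
    ⟨a / (1 - a), div_pos ha (sub_pos.2 ha1), by
      have := (sub_pos.2 ha1).ne'
      field_simp
      ring⟩
  have hK0 : 0 < ∫ w : E, Real.exp (-(1 + b) * ‖w‖ ^ 2) := integral_gaussian_pos (by positivity)
  obtain ⟨K, hK⟩ : ∃ K : ℝ, K = ∫ w : E, Real.exp (-(1 + b) * ‖w‖ ^ 2) := ⟨_, rfl⟩
  rw [← hK] at hK0
  have hgi : Integrable fun w : E ↦ (K : ℂ)⁻¹ * (Real.exp (-b * ‖w‖ ^ 2) : ℂ) :=
    (integrable_gaussian hb).ofReal.const_mul _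
  refine ⟨fun w ↦ ‖(K : ℂ)⁻¹ * (Real.exp (-b * ‖w‖ ^ 2) : ℂ)‖ₑ, by fun_prop, hgi.2.ne,
    fun f hf x ξ ↦ ?_⟩
  have hrep : gabor a f x ξ =
      ∫ w, (K : ℂ)⁻¹ * (Real.exp (-b * ‖w‖ ^ 2) : ℂ) * gabor 1 f (x + w) ξ := by
    simp only [mul_assoc]
    rw [integral_const_mul, integral_gaussian_mul_gabor hb hf, hab, ← hK,
      inv_mul_cancel_left₀ (by exact_mod_cast hK0.ne')]
  rw [hrep]
  refine (enorm_integral_le_lintegral_enorm _).trans_eq (lintegral_congr fun w ↦ ?_)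
  rw [enorm_mul]

/-- The mixed norm for a wider Gaussian window is controlled by that for the standard one. -/
lemma exists_mixedNorm_gabor_le {a : ℝ} (ha : 0 < a) (ha1 : a ≤ 1) :
    ∃ C : ℝ≥0∞, C ≠ ∞ ∧ ∀ p q : ℝ≥0∞, 1 ≤ p → 1 ≤ q → ∀ f : E → ℂ, Integrable f →
      mixedNorm p q (fun x ξ ↦ ‖gabor a f x ξ‖ₑ) ≤
        C * mixedNorm p q (fun x ξ ↦ ‖gabor 1 f x ξ‖ₑ) := by
  rcases ha1.eq_or_lt with rfl | ha1
  · exact ⟨1, ENNReal.one_ne_top, fun _ _ _ _ _ _ ↦ by rw [one_mul]⟩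
  obtain ⟨g, hgm, hgi, hpt⟩ := exists_enorm_gabor_le (E := E) ha ha1
  refine ⟨∫⁻ w, g w, hgi, fun p q hp hq f hf ↦ ?_⟩
  have h₁ := mixedNorm_mono (p := p) (q := q) (hpt f hf)
  have h₂ := mixedNorm_lintegral_translate_le hp hq hgm (measurable_enorm_gabor zero_le_one hf)
  exact h₁.trans h₂

end MixedNorm

section Products

open scoped SchwartzMap

variable {E : Type*} [NormedAddCommGroup E] [InnerProductSpace ℝ E]

lemma exists_schwartz_prod {m : ℕ} (f : Fin (m + 1) → 𝓢(E, ℂ)) :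
    ∃ g : 𝓢(E, ℂ), ∀ y, g y = ∏ i, f i y := by
  induction m with
  | zero => exact ⟨f 0, fun y ↦ by simp⟩
  | succ m ih =>
    obtain ⟨g, hg⟩ := ih fun i ↦ f i.succ
    refine ⟨SchwartzMap.pairing (ContinuousLinearMap.mul ℂ ℂ) (f 0) g, fun y ↦ ?_⟩
    rw [SchwartzMap.pairing_apply_apply, ContinuousLinearMap.mul_apply', Fin.prod_univ_succ, hg]

lemma one_div_le_one_of_one_le {s : ℝ≥0∞} (hs : 1 ≤ s) : 1 / s ≤ 1 := by
  rw [one_div]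
  exact ENNReal.inv_le_one.2 hs

variable [FiniteDimensional ℝ E] [MeasurableSpace E] [BorelSpace E]

/-- The multilinear estimate with constant one, for Gaussian windows of varying widths. -/
lemma mixedNorm_gabor_prod_le {a : ℝ} (ha : 0 ≤ a) {m : ℕ} {p₀ q₀ : ℝ≥0∞}
    {p q : Fin (m + 1) → ℝ≥0∞} (hp₀ : 1 ≤ p₀) (hq₀ : 1 ≤ q₀) (hp : ∀ i, 1 ≤ p i)
    (hq : ∀ i, 1 ≤ q i) (hpsum : ∑ i, 1 / p i = 1 / p₀) (hqsum : ∑ i, 1 / q i = m + 1 / q₀)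
    (f : Fin (m + 1) → 𝓢(E, ℂ)) :
    mixedNorm p₀ q₀ (fun x ξ ↦ ‖gabor ((m + 1) * a) (fun y ↦ ∏ i, f i y) x ξ‖ₑ) ≤
      ∏ i, mixedNorm (p i) (q i) (fun x ξ ↦ ‖gabor a (f i) x ξ‖ₑ) := by
  induction m generalizing p₀ q₀ with
  | zero =>
    have hp0 : p 0 = p₀ := by simpa using hpsum
    have hq0 : q 0 = q₀ := by simpa using hqsum
    simp [hp0, hq0]
  | succ m ih =>
    obtain ⟨g, hg⟩ := exists_schwartz_prod fun i ↦ f i.succ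
    rw [Fin.sum_univ_succ] at hpsum hqsum
    set S := ∑ i : Fin (m + 1), 1 / p i.succ with hS
    set T := ∑ i : Fin (m + 1), 1 / q i.succ
    have hS1 : S ≤ 1 := (le_add_self.trans hpsum.le).trans (one_div_le_one_of_one_le hp₀)
    have hTm : (m : ℝ≥0∞) ≤ T := by
      have h : 1 + (m : ℝ≥0∞) ≤ 1 + T := calc
        1 + (m : ℝ≥0∞) ≤ 1 / q 0 + T := by
          rw [hqsum, add_comm]
          push_cast
          exact le_self_add
        _ ≤ 1 + T := by gcongr; exact one_div_le_one_of_one_le (hq 0)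
      exact (ENNReal.add_le_add_iff_left ENNReal.one_ne_top).1 h
    have hT1 : T - m ≤ 1 := by
      rw [tsub_le_iff_left]
      calc T ≤ ∑ _i : Fin (m + 1), (1 : ℝ≥0∞) :=
            Finset.sum_le_sum fun i _ ↦ one_div_le_one_of_one_le (hq i.succ)
        _ = m + 1 := by simp
    have hqq : 1 / q 0 + 1 / (T - m)⁻¹ = 1 + 1 / q₀ := by
      rw [one_div (T - m)⁻¹, inv_inv]
      refine (ENNReal.add_right_inj (ENNReal.natCast_ne_top m)).1 ?_
      rw [add_left_comm, add_tsub_cancel_of_le hTm, hqsum]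
      push_cast
      ring
    have hind := ih (p₀ := S⁻¹) (q₀ := (T - m)⁻¹) (p := fun i ↦ p i.succ) (q := fun i ↦ q i.succ)
      (ENNReal.one_le_inv.2 hS1) (ENNReal.one_le_inv.2 hT1) (fun i ↦ hp i.succ)
      (fun i ↦ hq i.succ) (by simp [hS]) (by
        rw [one_div (T - m)⁻¹, inv_inv, add_tsub_cancel_of_le hTm]) fun i ↦ f i.succ
    have hb : 0 ≤ ((m : ℝ) + 1) * a := by positivity
    have hprod : (fun y ↦ ∏ i, f i y) = fun y ↦ f 0 y * g y := by
      funext y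
      rw [Fin.prod_univ_succ, hg]
    simp only [← hg] at hind
    rw [Fin.prod_univ_succ, hprod]
    push_cast
    rw [show ((m : ℝ) + 1 + 1) * a = a + (m + 1) * a by ring]
    have h₁ := mixedNorm_mono (p := p₀) (q := q₀) (enorm_gabor_mul_le ha hb (f 0) g)
    have h₂ := mixedNorm_convolution_le hp₀ hq₀ (hp 0) (hq 0) (ENNReal.one_le_inv.2 hS1)
      (ENNReal.one_le_inv.2 hT1) (by rw [one_div S⁻¹, inv_inv, hpsum]) hqq
      (measurable_enorm_gabor ha (f 0).integrable) (measurable_enorm_gabor hb g.integrable)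
    exact h₁.trans (h₂.trans (mul_le_mul_right hind _))

lemma modNorm_eq_mixedNorm {n : ℕ} (p q : ℝ≥0∞) (f : EuclideanSpace ℝ (Fin n) → ℂ) :
    modNorm n p q f = mixedNorm p q fun x ξ ↦ ‖gabor 1 f x ξ‖ₑ := by
  simp [modNorm, mixedNorm, STFT, gabor]

end Products

/-- **Algebra property of modulation spaces.** If `∑ 1/pᵢ = 1/p₀` and
`∑ 1/qᵢ = m - 1 + 1/q₀`, then `‖∏ fᵢ‖_{M^{p₀,q₀}} ≤ C ∏ ‖fᵢ‖_{M^{pᵢ,qᵢ}}` for all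
Schwartz functions `f₁, …, f_m`. -/
theorem modulation_multilinear_estimate (n m : ℕ) (hn : 1 ≤ n) (hm : 1 ≤ m)
    (p₀ q₀ : ℝ≥0∞) (p q : Fin m → ℝ≥0∞)
    (hp₀ : 1 ≤ p₀) (hq₀ : 1 ≤ q₀) (hp : ∀ i, 1 ≤ p i) (hq : ∀ i, 1 ≤ q i)
    (hpsum : (∑ i, 1 / p i) = 1 / p₀)
    (hqsum : (∑ i, 1 / q i) = (m - 1 : ℕ) + 1 / q₀) :
    ∃ C : ℝ, 0 < C ∧ ∀ f : Fin m → SchwartzMap (EuclideanSpace ℝ (Fin n)) ℂ,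
      modNorm n p₀ q₀ (fun y => ∏ i, f i y) ≤
        ENNReal.ofReal C * ∏ i, modNorm n (p i) (q i) (f i) := by
  obtain ⟨m, rfl⟩ := Nat.exists_eq_succ_of_ne_zero (Nat.one_le_iff_ne_zero.1 hm)
  have hm0 : (0 : ℝ) < m + 1 := by positivity
  obtain ⟨C, hC, hbound⟩ := exists_mixedNorm_gabor_le (E := EuclideanSpace ℝ (Fin n))
    (a := ((m : ℝ) + 1)⁻¹) (by positivity) (inv_le_one_of_one_le₀ (by simp))
  refine ⟨(C ^ (m + 1)).toReal + 1, by positivity, fun f ↦ ?_⟩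
  have hCm : C ^ (m + 1) ≤ ENNReal.ofReal ((C ^ (m + 1)).toReal + 1) := by
    rw [← ENNReal.ofReal_toReal (ENNReal.pow_ne_top hC), ENNReal.toReal_ofReal (by positivity)]
    exact ENNReal.ofReal_le_ofReal (by linarith)
  have hmain := mixedNorm_gabor_prod_le (a := ((m : ℝ) + 1)⁻¹) (by positivity) hp₀ hq₀ hp hq hpsum
    hqsum f
  rw [mul_inv_cancel₀ hm0.ne'] at hmain
  simp only [modNorm_eq_mixedNorm]
  calc mixedNorm p₀ q₀ (fun x ξ ↦ ‖gabor 1 (fun y ↦ ∏ i, f i y) x ξ‖ₑ)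
      ≤ ∏ i, mixedNorm (p i) (q i) (fun x ξ ↦ ‖gabor ((m : ℝ) + 1)⁻¹ (f i) x ξ‖ₑ) := hmain
    _ ≤ ∏ i, C * mixedNorm (p i) (q i) (fun x ξ ↦ ‖gabor 1 (f i) x ξ‖ₑ) :=
        Finset.prod_le_prod' fun i _ ↦ hbound _ _ (hp i) (hq i) _ (f i).integrable
    _ = C ^ (m + 1) * ∏ i, mixedNorm (p i) (q i) (fun x ξ ↦ ‖gabor 1 (f i) x ξ‖ₑ) := by
        rw [Finset.prod_mul_distrib, Finset.prod_const, Finset.card_univ, Fintype.card_fin]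
    _ ≤ _ := mul_le_mul_left hCm _
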